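/- Under the stated hypotheses on Φ and f, the second partial derivative of the component Y2 with respect to x2 twice vanishes at the origin: Y2_{x2x2}(0) = 0. -/

import Mathlib

noncomputable section

/-- The model space `ℝ^13` with coordinates
`(t, x0, y0, x1, y1, x2, y2, x3, y3, x4, y4, x5, y5)`
indexed by `0, 1, ..., 12` respectively. -/
abbrev E13 := Fin 13 → ℝ

/-- The constant coordinate vector field `∂_u` of the `i`-th coordinate. -/
def e (i : Fin 13) : E13 := Pi.single i 1

/-- Partial derivative of a scalar function `F` in the `i`-th coordinate
direction, at a point `p`. -/
def pd (F : E13 → ℝ) (i : Fin 13) (p : E13) : ℝ := fderiv ℝ F p (e i)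

/-- The vector field `Z'_{1,a}` of the EKR pseudo-normal form for the
singularity class 1.2.2.1.2:
`Z'_{1,a} = ∂_{x4} + (a + y5)·∂_{y4} + x5·( ∂_{x2} + y3·∂_{y2} + (1 + x4)·∂_{x3}
 + (1 + y4)·∂_{y3} + x3·( ∂_{x1} + y2·∂_{y1} + x2·( ∂_t + x1·∂_{x0} + y1·∂_{y0} ) ) )`. -/
def Z (a : ℝ) (p : E13) : E13 :=
  e 9 + (a + p 12) • e 10 +
    p 11 • (e 5 + p 8 • e 6 + (1 + p 9) • e 7 + (1 + p 10) • e 8 +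
      p 7 • (e 3 + p 6 • e 4 + p 5 • (e 0 + p 3 • e 1 + p 4 • e 2)))

open Filter Topology

/-- A function that is locally constant along the `i`-th coordinate line through `p` has vanishing
`i`-th partial derivative at `p`; no differentiability is required. -/
theorem pd_eq_zero_of_eventually {F : E13 → ℝ} {i : Fin 13} {p : E13}
    (h : ∀ᶠ s : ℝ in 𝓝 0, F (p + s • e i) = F p) : pd F i p = 0 := by
  unfold pd
  by_cases hF : DifferentiableAt ℝ F p
  · rw [← hF.lineDeriv_eq_fderiv, lineDeriv]
    have hc : (fun s : ℝ => F (p + s • e i)) =ᶠ[𝓝 0] fun _ => F p := h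
    rw [hc.deriv_eq, deriv_const]
  · simp [fderiv_zero_of_not_differentiableAt hF]

/-- If `F` vanishes on a neighbourhood of `0` in the `i`-th coordinate axis, then so does its second
derivative along that axis. -/
theorem pd_pd_eq_zero_of_eventually {F : E13 → ℝ} {i : Fin 13}
    (h : ∀ᶠ s : ℝ in 𝓝 0, F (s • e i) = 0) : pd (pd F i) i 0 = 0 := by
  have h1 : ∀ᶠ s : ℝ in 𝓝 0, pd F i (s • e i) = 0 := by
    filter_upwards [eventually_eventually_nhds.2 h] with s hs
    apply pd_eq_zero_of_eventually
    have ht : Tendsto (fun r : ℝ => s + r) (𝓝 0) (𝓝 s) := by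
      simpa using (continuous_const_add s).tendsto (0 : ℝ)
    filter_upwards [ht.eventually hs] with r hr
    rw [← add_smul, hr, hs.self_of_nhds]
  apply pd_eq_zero_of_eventually
  have h2 : pd F i 0 = 0 := by simpa using h1.self_of_nhds
  simpa [h2] using h1

/-- `F` depends only on the coordinates of index at most `n`. -/
def DependsUpTo (n : ℕ) (F : E13 → ℝ) : Prop :=
  ∀ p q : E13, (∀ k : Fin 13, (k : ℕ) ≤ n → p k = q k) → F p = F q

theorem DependsUpTo.pd_eq_zero {n : ℕ} {F : E13 → ℝ} (hF : DependsUpTo n F) {i : Fin 13}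
    (hi : n < i) (p : E13) : pd F i p = 0 := by
  refine pd_eq_zero_of_eventually (Eventually.of_forall fun s => hF _ _ fun k hk => ?_)
  have hki : k ≠ i := by rintro rfl; omega
  simp [e, hki]

/-- The partial derivatives of `F` depend only on the coordinates `F` depends on. -/
theorem DependsUpTo.pd_eq_pd_zero {n : ℕ} {F : E13 → ℝ} (hF : DependsUpTo n F) (i : Fin 13)
    {p : E13} (hp : ∀ k : Fin 13, (k : ℕ) ≤ n → p k = 0) : pd F i p = pd F i 0 := by
  have hshift : (fun q => F (q + p)) = F := by
    funext q
    exact hF _ _ fun k hk => by simp [hp k hk]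
  have h := fderiv_comp_add_right (𝕜 := ℝ) (f := F) (x := 0) p
  rw [hshift, zero_add] at h
  rw [pd, pd, h]

/-- The derivative of `F` along `Z a`, in terms of partial derivatives. -/
theorem fderiv_Z (a : ℝ) (F : E13 → ℝ) (p : E13) :
    fderiv ℝ F p (Z a p) = pd F 9 p + (a + p 12) * pd F 10 p +
      p 11 * (pd F 5 p + p 8 * pd F 6 p + (1 + p 9) * pd F 7 p + (1 + p 10) * pd F 8 p +
        p 7 * (pd F 3 p + p 6 * pd F 4 p +
          p 5 * (pd F 0 p + p 3 * pd F 1 p + p 4 * pd F 2 p))) := by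
  simp only [Z, pd, map_add, map_smul, smul_eq_mul]

theorem apply_eq_zero_of_mem_span {v : E13}
    (hv : v ∈ Submodule.span ℝ ({e 11, e 12} : Set E13)) {i : Fin 13} (hi : (i : ℕ) ≤ 10) :
    v i = 0 := by
  obtain ⟨a, b, rfl⟩ := Submodule.mem_span_pair.1 hv
  have h1 : i ≠ 11 := by rintro rfl; simp at hi
  have h2 : i ≠ 12 := by rintro rfl; simp at hi
  simp [e, h1, h2]

theorem Z_apply_three (a : ℝ) (p : E13) : Z a p 3 = p 11 * p 7 := by
  simp [Z, e]

theorem Z_apply_four (a : ℝ) (p : E13) : Z a p 4 = p 11 * (p 7 * p 6) := by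
  simp [Z, e]

theorem Z_apply_six (a : ℝ) (p : E13) : Z a p 6 = p 11 * p 8 := by
  simp [Z, e]

/-- A function `y` with `α + s β = (a + s b) y(s)` near `0`, `a ≠ 0`, and vanishing `1`-jet at `0`
vanishes near `0`. -/
theorem eventually_eq_zero_of_affine_mul {a b α β : ℝ} {y : ℝ → ℝ} (ha : a ≠ 0) (hy0 : y 0 = 0)
    (hy : HasDerivAt y 0 0) (h : ∀ᶠ s in 𝓝 (0 : ℝ), α + s * β = (a + s * b) * y s) :
    ∀ᶠ s in 𝓝 (0 : ℝ), y s = 0 := by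
  have hα : α = 0 := by simpa [hy0] using h.self_of_nhds
  have hl : HasDerivAt (fun s : ℝ => α + s * β) β 0 := by
    simpa using ((hasDerivAt_id (0 : ℝ)).mul_const β).const_add α
  have hm : HasDerivAt (fun s : ℝ => a + s * b) b 0 := by
    simpa using ((hasDerivAt_id (0 : ℝ)).mul_const b).const_add a
  have hr : HasDerivAt (fun s : ℝ => (a + s * b) * y s) 0 0 := by
    simpa [hy0] using hm.fun_mul hy
  have hβ : β = 0 := hl.unique (hr.congr_of_eventuallyEq h)
  have hne : ∀ᶠ s in 𝓝 (0 : ℝ), a + s * b ≠ 0 :=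
    hm.continuousAt.eventually_ne (by simpa using ha)
  filter_upwards [h, hne] with s hs hs'
  rw [hα, hβ] at hs
  simpa [hs'] using hs.symm

/-- `Y2_{x2x2}(0) = 0`. -/
theorem observation_a_12212 (c c' : ℝ)
    (Φ : E13 → E13) (U : Set E13) (hU : IsOpen U) (h0U : (0 : E13) ∈ U)
    (hΦsmooth : ContDiffOn ℝ (⊤ : ℕ∞) Φ U) (hΦ0 : Φ 0 = 0)
    (hdiffeo : Function.Bijective (fderiv ℝ Φ 0))
    -- the components `T, X0, Y0` (indices 0,1,2) depend only on `t, x0, y0`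
    (htri0 : ∀ p q : E13, (∀ k : Fin 13, (k : ℕ) ≤ 2 → p k = q k) →
      ∀ i : Fin 13, (i : ℕ) ≤ 2 → Φ p i = Φ q i)
    -- for `1 ≤ j ≤ 5`, the components `Xj, Yj` (indices 2j+1, 2j+2)
    -- depend only on `t, x0, y0, x1, y1, ..., xj, yj`
    (htri : ∀ j : ℕ, 1 ≤ j → j ≤ 5 → ∀ p q : E13,
      (∀ k : Fin 13, (k : ℕ) ≤ 2 * j + 2 → p k = q k) →
      ∀ i : Fin 13, ((i : ℕ) = 2 * j + 1 ∨ (i : ℕ) = 2 * j + 2) → Φ p i = Φ q i)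
    (K H G : E13 → ℝ)
    (hKs : ContDiffOn ℝ (⊤ : ℕ∞) K U) (hHs : ContDiffOn ℝ (⊤ : ℕ∞) H U) (hGs : ContDiffOn ℝ (⊤ : ℕ∞) G U)
    (hK0 : K 0 ≠ 0) (hH0 : H 0 ≠ 0) (hG0 : G 0 ≠ 0)
    -- `X2 = x2·K`, `X3 = x3·H`, `X5 = x5·G`
    (hX2 : ∀ p ∈ U, Φ p 5 = p 5 * K p)
    (hX3 : ∀ p ∈ U, Φ p 7 = p 7 * H p)
    (hX5 : ∀ p ∈ U, Φ p 11 = p 11 * G p)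
    (f : E13 → ℝ) (hfs : ContDiffOn ℝ (⊤ : ℕ∞) f U) (hf0 : f 0 ≠ 0)
    -- `dΦ(p)·Z_{1,c}(p) − f(p)·Z_{1,c'}(Φ(p)) ∈ span{∂_{x5}, ∂_{y5}}` near 0
    (hconj : ∀ p ∈ U, fderiv ℝ Φ p (Z c p) - f p • Z c' (Φ p) ∈
      Submodule.span ℝ ({e 11, e 12} : Set E13)) :
    pd (pd (fun p => Φ p 6) 5) 5 0 = 0 := by
  have hUn : U ∈ 𝓝 (0 : E13) := hU.mem_nhds h0U
  have hdiff : ∀ p ∈ U, DifferentiableAt ℝ Φ p := fun p hp =>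
    (hΦsmooth.contDiffAt (hU.mem_nhds hp)).differentiableAt (by simp)
  have hdep3 : DependsUpTo 4 fun p => Φ p 3 :=
    fun p q h => htri 1 le_rfl (by norm_num) p q h 3 (by simp)
  have hdep4 : DependsUpTo 4 fun p => Φ p 4 :=
    fun p q h => htri 1 le_rfl (by norm_num) p q h 4 (by simp)
  have hdep6 : DependsUpTo 6 fun p => Φ p 6 :=
    fun p q h => htri 2 (by norm_num) (by norm_num) p q h 6 (by simp)
  have hdep8 : DependsUpTo 8 fun p => Φ p 8 :=
    fun p q h => htri 3 (by norm_num) (by norm_num) p q h 8 (by simp)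
  have hrow : ∀ p ∈ U, ∀ i : Fin 13, (i : ℕ) ≤ 10 →
      fderiv ℝ (fun q => Φ q i) p (Z c p) = f p * Z c' (Φ p) i := by
    intro p hp i hi
    have h := apply_eq_zero_of_mem_span (hconj p hp) hi
    rw [fderiv_apply (hdiff p hp) i]
    simpa [sub_eq_zero] using h
  -- the points at which the rows `X1`, `Y1` are evaluated
  let P : ℝ → ℝ → E13 := fun s u => s • e 5 + u • (e 7 + e 11)
  have hP0 : P 0 0 = 0 := by simp [P]
  have hPlow : ∀ s u, ∀ k : Fin 13, (k : ℕ) ≤ 4 → P s u k = 0 := by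
    intro s u k hk
    have h5 : k ≠ 5 := by rintro rfl; simp at hk
    have h7 : k ≠ 7 := by rintro rfl; simp at hk
    have h11 : k ≠ 11 := by rintro rfl; simp at hk
    simp [P, e, h5, h7, h11]
  have hP6 : ∀ s u, Φ (P s u) 6 = Φ (s • e 5) 6 := by
    intro s u
    refine hdep6 _ _ fun k hk => ?_
    have h7 : k ≠ 7 := by rintro rfl; simp at hk
    have h11 : k ≠ 11 := by rintro rfl; simp at hk
    simp [P, e, h7, h11]
  have hlhs : ∀ F : E13 → ℝ, DependsUpTo 4 F → ∀ s u,
      fderiv ℝ F (P s u) (Z c (P s u)) = u * u * (pd F 3 0 + s * pd F 0 0) := by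
    intro F hF s u
    rw [fderiv_Z, hF.pd_eq_zero (i := 9) (by simp), hF.pd_eq_zero (i := 10) (by simp),
      hF.pd_eq_zero (i := 5) (by simp), hF.pd_eq_zero (i := 6) (by simp),
      hF.pd_eq_zero (i := 7) (by simp), hF.pd_eq_zero (i := 8) (by simp),
      hF.pd_eq_pd_zero 3 (hPlow s u), hF.pd_eq_pd_zero 0 (hPlow s u)]
    simp [P, e]
    ring
  have hX1 : ∀ s u, P s u ∈ U → u ≠ 0 →
      pd (fun p => Φ p 3) 3 0 + s * pd (fun p => Φ p 3) 0 0 =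
        f (P s u) * G (P s u) * H (P s u) := by
    intro s u hp hu
    have h := hrow _ hp 3 (by simp)
    rw [hlhs _ hdep3, Z_apply_three, hX5 _ hp, hX3 _ hp] at h
    apply mul_left_cancel₀ (mul_ne_zero hu hu)
    rw [h]
    simp [P, e]
    ring
  have hY1 : ∀ s u, P s u ∈ U → u ≠ 0 →
      pd (fun p => Φ p 4) 3 0 + s * pd (fun p => Φ p 4) 0 0 =
        f (P s u) * G (P s u) * H (P s u) * Φ (s • e 5) 6 := by
    intro s u hp hu
    have h := hrow _ hp 4 (by simp)
    rw [hlhs _ hdep4, Z_apply_four, hX5 _ hp, hX3 _ hp, hP6] at h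
    apply mul_left_cancel₀ (mul_ne_zero hu hu)
    rw [h]
    simp [P, e]
    ring
  have hne : ∀ᶠ u : ℝ in 𝓝[≠] 0, u ≠ 0 := self_mem_nhdsWithin
  have ha : pd (fun p => Φ p 3) 3 0 ≠ 0 := by
    have hcont : ContinuousAt (fun p => f p * G p * H p) 0 :=
      ((hfs.continuousOn.continuousAt hUn).mul (hGs.continuousOn.continuousAt hUn)).mul
        (hHs.continuousOn.continuousAt hUn)
    have hev : ∀ᶠ p in 𝓝 (0 : E13), p ∈ U ∧ f p * G p * H p ≠ 0 :=
      (eventually_mem_set.2 hUn).and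
        (hcont.eventually_ne (mul_ne_zero (mul_ne_zero hf0 hG0) hH0))
    have ht : Tendsto (fun u => P 0 u) (𝓝 0) (𝓝 0) :=
      (show Continuous fun u => P 0 u by fun_prop).tendsto' _ _ hP0
    obtain ⟨u, ⟨huU, hu⟩, hu0⟩ :=
      ((ht.eventually hev).filter_mono nhdsWithin_le_nhds |>.and hne).exists
    have h := hX1 0 u huU hu0
    rw [zero_mul, add_zero] at h
    rwa [h]
  have hmul : ∀ᶠ s : ℝ in 𝓝 0,
      pd (fun p => Φ p 4) 3 0 + s * pd (fun p => Φ p 4) 0 0 =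
        (pd (fun p => Φ p 3) 3 0 + s * pd (fun p => Φ p 3) 0 0) * Φ (s • e 5) 6 := by
    have ht : Tendsto (fun s => P s 0) (𝓝 0) (𝓝 0) :=
      (show Continuous fun s => P s 0 by fun_prop).tendsto' _ _ hP0
    filter_upwards [ht.eventually (eventually_mem_set.2 hUn)] with s hs
    have hu : ∀ᶠ u in 𝓝 (0 : ℝ), P s u ∈ U :=
      (show Continuous fun u => P s u by fun_prop).continuousAt.eventually (hU.mem_nhds hs)
    obtain ⟨u, huU, hu0⟩ := (hu.filter_mono nhdsWithin_le_nhds |>.and hne).exists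
    rw [hX1 s u huU hu0, hY1 s u huU hu0]
  have hY2 : pd (fun p => Φ p 6) 5 0 = 0 := by
    have ht : Tendsto (fun u : ℝ => u • e 11) (𝓝 0) (𝓝 0) :=
      (show Continuous fun u : ℝ => u • e 11 by fun_prop).tendsto' _ _ (by simp)
    obtain ⟨u, huU, hu0⟩ := ((ht.eventually (eventually_mem_set.2 hUn)).filter_mono
      nhdsWithin_le_nhds |>.and hne).exists
    have hlow : ∀ k : Fin 13, (k : ℕ) ≤ 8 → (u • e 11) k = 0 := by
      intro k hk
      have h11 : k ≠ 11 := by rintro rfl; simp at hk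
      simp [e, h11]
    have h8 : Φ (u • e 11) 8 = 0 := by
      have h : Φ (u • e 11) 8 = Φ 0 8 := hdep8 _ _ hlow
      rw [h, hΦ0, Pi.zero_apply]
    have h := hrow _ huU 6 (by simp)
    rw [Z_apply_six, h8, fderiv_Z, hdep6.pd_eq_zero (i := 9) (by simp),
      hdep6.pd_eq_zero (i := 10) (by simp), hdep6.pd_eq_zero (i := 7) (by simp),
      hdep6.pd_eq_zero (i := 8) (by simp),
      hdep6.pd_eq_pd_zero 5 fun k hk => hlow k (hk.trans (by norm_num))] at h
    simpa [e, hu0] using h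
  have hderiv : HasDerivAt (fun s : ℝ => Φ (s • e 5) 6) 0 0 := by
    have hd : DifferentiableAt ℝ (fun p => Φ p 6) 0 := differentiableAt_pi.1 (hdiff 0 h0U) 6
    have h := hd.hasFDerivAt.hasLineDerivAt (e 5)
    rw [HasLineDerivAt, show fderiv ℝ (fun p => Φ p 6) 0 (e 5) = 0 from hY2] at h
    simpa using h
  exact pd_pd_eq_zero_of_eventually
    (eventually_eq_zero_of_affine_mul ha (by simp [hΦ0]) hderiv hmul)
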